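/- arXiv:1606.04025 — 5 statements merged into one kernel-verified Lean document; each statement's English description precedes it below -/
import Mathlib

section
/- For every ordinal κ, the space C_p(κ) of continuous real-valued functions on κ with the topology of pointwise convergence is an Ascoli space. -/
open Topology

/-- `Cp X` is the space `C(X, ℝ)` endowed with the topology of pointwise convergence. -/
def Cp (X : Type*) [TopologicalSpace X] : Type _ := C(X, ℝ)

namespace Cp

variable {X : Type*} [TopologicalSpace X]

instance : FunLike (Cp X) X ℝ where
  coe f := ⇑(show C(X, ℝ) from f)
  coe_injective := ContinuousMap.coe_injective

/-- The topology of pointwise convergence on `Cp X`. -/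
instance : TopologicalSpace (Cp X) :=
  TopologicalSpace.induced (fun f : Cp X => (f : X → ℝ)) Pi.topologicalSpace

end Cp

/-- A topological space `Y` is Ascoli if the canonical evaluation map
`Y → C_k(C_k(Y))`, `y ↦ (f ↦ f y)`, is a topological embedding (here `C(·, ℝ)`
carries the compact-open topology). -/
def AscoliSpace (Y : Type*) [TopologicalSpace Y] : Prop :=
  IsEmbedding fun y : Y =>
    (⟨fun f : C(Y, ℝ) => f y, ContinuousEvalConst.continuous_eval_const y⟩ : C(C(Y, ℝ), ℝ))

/-- A topological space `Y` is a `k_ℝ`-space if every real-valued function whose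
restriction to every compact subset is continuous is itself continuous. -/
def KRSpace (Y : Type*) [TopologicalSpace Y] : Prop :=
  ∀ g : Y → ℝ, (∀ K : Set Y, IsCompact K → ContinuousOn g K) → Continuous g

/-- A topological space is scattered if every nonempty subset has a point isolated in it. -/
def Scattered (X : Type*) [TopologicalSpace X] : Prop :=
  ∀ A : Set X, A.Nonempty → ∃ a ∈ A, ∃ U : Set X, IsOpen U ∧ U ∩ A = {a}

/-- A space is hemicompact if it has a countable family of compact sets such that every
compact subset is contained in one of them. -/
def Hemicompact (X : Type*) [TopologicalSpace X] : Prop :=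
  ∃ K : ℕ → Set X, (∀ n, IsCompact (K n)) ∧ ∀ C : Set X, IsCompact C → ∃ n, C ⊆ K n

/-- A space is countably compact if every countable open cover has a finite subcover. -/
def CountablyCompact (X : Type*) [TopologicalSpace X] : Prop :=
  ∀ U : ℕ → Set X, (∀ n, IsOpen (U n)) → (⋃ n, U n) = Set.univ →
    ∃ s : Finset ℕ, (⋃ n ∈ s, U n) = Set.univ

open Filter

/-- The points of a linear order whose least upper bound in the finite set `G` exists and does not
belong to `F`. -/
def newGap {α : Type*} [LinearOrder α] (F G : Finset α) : Set α :=
  ⋃ d ∈ G \ F, Set.Iic d ∩ ⋂ e ∈ G.filter (· < d), Set.Ioi e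

lemma mem_newGap {α : Type*} [LinearOrder α] {F G : Finset α} {x : α} :
    x ∈ newGap F G ↔ ∃ d ∈ G, d ∉ F ∧ x ≤ d ∧ ∀ e ∈ G, e < d → e < x := by
  simp only [newGap, Set.mem_iUnion, Finset.mem_sdiff, Set.mem_inter_iff, Set.mem_Iic,
    Set.mem_iInter, Finset.mem_filter, Set.mem_Ioi, exists_prop, and_imp, and_assoc]

lemma mem_newGap_of_mem {α : Type*} [LinearOrder α] {F G : Finset α} {x : α}
    (hG : x ∈ G) (hF : x ∉ F) : x ∈ newGap F G :=
  mem_newGap.2 ⟨x, hG, hF, le_rfl, fun _ _ h => h⟩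

lemma isClopen_newGap (F G : Finset Ordinal) : IsClopen (newGap F G) := by
  have hIic (d : Ordinal) : IsClopen (Set.Iic d) :=
    ⟨isClosed_Iic, by rw [← Order.Iio_succ]; exact isOpen_Iio⟩
  refine isClopen_biUnion_finset fun d _ => (hIic d).inter (isClopen_biInter_finset fun e _ => ?_)
  rw [← Set.compl_Iic]
  exact (hIic e).compl

/-- The gaps created by an increasing sequence of finite sets form a point-finite family. -/
lemma eventually_notMem_newGap {α : Type*} [LinearOrder α] [WellFoundedLT α]
    {F : ℕ → Finset α} (hF : Monotone F) (x : α) :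
    ∀ᶠ n in atTop, x ∉ newGap (F n) (F (n + 1)) := by
  by_cases h : ∃ y, x ≤ y ∧ ∃ n, y ∈ F n
  · obtain ⟨y, ⟨hxy, N, hN⟩, hmin⟩ := WellFounded.has_min wellFounded_lt
      {y | x ≤ y ∧ ∃ n, y ∈ F n} h
    filter_upwards [eventually_ge_atTop N] with n hn hx
    obtain ⟨d, hdG, hdF, hxd, hd⟩ := mem_newGap.1 hx
    have hyd : y < d := lt_of_le_of_ne (not_lt.1 (hmin d ⟨hxd, n + 1, hdG⟩))
      fun h => hdF (h ▸ hF hn hN)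
    exact (hd y (hF (hn.trans n.le_succ) hN) hyd).not_ge hxy
  · refine Eventually.of_forall fun n hx => h ?_
    obtain ⟨d, hdG, _, hxd, _⟩ := mem_newGap.1 hx
    exact ⟨d, hxd, n + 1, hdG⟩

/-- If every point in the closure of an open set is the limit of a sequence in that set, then
compact sets of continuous functions are equicontinuous, so evaluation into the double function
space is continuous. -/
lemma continuous_eval_of_exists_seq_of_isOpen {Y : Type*} [TopologicalSpace Y]
    (hY : ∀ (W : Set Y) (y : Y), IsOpen W → y ∈ closure W →
      ∃ u : ℕ → Y, (∀ n, u n ∈ W) ∧ Tendsto u atTop (𝓝 y)) :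
    Continuous fun y : Y =>
      (⟨fun f : C(Y, ℝ) => f y, ContinuousEvalConst.continuous_eval_const y⟩ : C(C(Y, ℝ), ℝ)) := by
  refine continuous_iff_continuousAt.2 fun y => ?_
  refine ContinuousMap.tendsto_iff_forall_isCompact_tendstoUniformlyOn.2 fun K hK => ?_
  refine Metric.tendstoUniformlyOn_iff.2 fun ε hε => ?_
  by_contra hcon
  let W : Set Y := ⋃ f ∈ K, {z | ε / 2 < dist (f y) (f z)}
  have hW : IsOpen W := isOpen_biUnion fun f _ =>
    isOpen_lt continuous_const (continuous_const.dist f.continuous)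
  have hyW : y ∈ closure W := by
    refine mem_closure_iff_frequently.2 ((not_eventually.1 hcon).mono fun z hz => ?_)
    push Not at hz
    obtain ⟨f, hf, hfz⟩ := hz
    exact Set.mem_biUnion hf ((half_lt_self hε).trans_le hfz)
  obtain ⟨u, huW, hu⟩ := hY W y hW hyW
  let T : C(OnePoint ℕ, Y) := OnePoint.continuousMapMkNat u y hu
  have hT : Continuous fun p : OnePoint ℕ × C(Y, ℝ) => p.2 (T p.1) :=
    continuous_eval.comp
      (((ContinuousMap.continuous_precomp T).comp continuous_snd).prodMk continuous_fst)
  have hT' : Continuous fun p : OnePoint ℕ × C(Y, ℝ) => dist (p.2 y) (p.2 (T p.1)) :=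
    ((ContinuousEvalConst.continuous_eval_const y).comp continuous_snd).dist hT
  have hev : ∀ᶠ t in 𝓝 (OnePoint.infty : OnePoint ℕ), ∀ f ∈ K, dist (f y) (f (T t)) < ε / 2 := by
    refine hK.eventually_forall_of_forall_eventually fun f _ => ?_
    refine (hT'.tendsto (OnePoint.infty, f)).eventually_lt_const ?_
    have : T OnePoint.infty = y := rfl
    simpa [this] using hε
  have hcoe : Tendsto ((↑) : ℕ → OnePoint ℕ) atTop (𝓝 OnePoint.infty) := by
    simpa [Nat.cofinite_eq_atTop] using
      (OnePoint.tendsto_coe_infty (X := ℕ))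
  obtain ⟨n, hn⟩ := (hcoe.eventually hev).exists
  obtain ⟨f, hf, hfn⟩ := Set.mem_iUnion₂.1 (huW n)
  exact (hn f hf).not_gt hfn

namespace Cp

variable {X : Type*} [TopologicalSpace X]

lemma isEmbedding_coe : IsEmbedding fun f : Cp X => (f : X → ℝ) :=
  ⟨⟨rfl⟩, DFunLike.coe_injective⟩

/-- Evaluation at a point, as a continuous function on `Cp X`. -/
def evalAt (x : X) : C(Cp X, ℝ) :=
  ⟨fun f => f x, (continuous_apply x).comp isEmbedding_coe.continuous⟩

/-- An open set meeting every neighbourhood of `f₀` contains functions close to `f₀` on a given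
finite set, and membership is decided by the values on a larger finite set. -/
lemma exists_mem_of_mem_closure {W : Set (Cp X)} (hW : IsOpen W) {f₀ : Cp X}
    (hf₀ : f₀ ∈ closure W) (F : Finset X) {δ : ℝ} (hδ : 0 < δ) :
    ∃ (g : Cp X) (G : Finset X), F ⊆ G ∧ (∀ x ∈ F, |g x - f₀ x| < δ) ∧
      ∀ h : Cp X, (∀ x ∈ G, h x = g x) → h ∈ W := by
  classical
  have hN : ∀ᶠ g in 𝓝 f₀, ∀ x ∈ F, |g x - f₀ x| < δ := by
    refine (Finset.eventually_all F).2 fun x _ => ?_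
    have hc : Continuous fun g : Cp X => |g x - f₀ x| :=
      ((evalAt x).continuous.sub continuous_const).abs
    exact (hc.tendsto f₀).eventually_lt_const (by simpa using hδ)
  obtain ⟨g, hgW, hg⟩ := ((mem_closure_iff_frequently.1 hf₀).and_eventually hN).exists
  obtain ⟨V, hV, rfl⟩ := isOpen_induced_iff.1 hW
  obtain ⟨I, v, hv, hIV⟩ := isOpen_pi_iff.1 hV _ hgW
  refine ⟨g, F ∪ I, Finset.subset_union_left, hg, fun h hh => hIV fun x hx => ?_⟩
  change h x ∈ v x
  rw [hh x (Finset.mem_union_right F hx)]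
  exact (hv x hx).2

/-- In the space `Cp` of an ordinal, closures of open sets are sequential. -/
lemma exists_seq_of_mem_closure_isOpen {κ : Ordinal} (W : Set (Cp (Set.Iio κ)))
    (f₀ : Cp (Set.Iio κ)) (hW : IsOpen W) (hf₀ : f₀ ∈ closure W) :
    ∃ u : ℕ → Cp (Set.Iio κ), (∀ n, u n ∈ W) ∧ Tendsto u atTop (𝓝 f₀) := by
  classical
  have hδ (n : ℕ) : (0 : ℝ) < 1 / ((n : ℝ) + 1) := Nat.one_div_pos_of_nat
  choose g G hFG hg hGW using fun (F : Finset (Set.Iio κ)) (n : ℕ) =>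
    exists_mem_of_mem_closure hW hf₀ F (hδ n)
  let F : ℕ → Finset (Set.Iio κ) := fun n => Nat.rec ∅ (fun n F => G F n) n
  have hF : Monotone F := monotone_nat_of_le_succ fun n => hFG (F n) n
  let E : ℕ → Finset Ordinal := fun n => (F n).image (↑)
  have hE : Monotone E := fun m n h => Finset.image_subset_image (hF h)
  let U : ℕ → Set (Set.Iio κ) := fun n => (↑) ⁻¹' newGap (E n) (E (n + 1))
  have hU (n : ℕ) : IsClopen (U n) := (isClopen_newGap _ _).preimage continuous_subtype_val
  let c (n : ℕ) (x : Set.Iio κ) : ℝ :=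
    f₀ x + max (-(1 / ((n : ℝ) + 1))) (min (1 / ((n : ℝ) + 1)) (g (F n) n x - f₀ x))
  have hcont (f : Cp (Set.Iio κ)) : Continuous fun x => f x := ContinuousMap.continuous f
  have hc (n : ℕ) : Continuous (c n) :=
    (hcont f₀).add (continuous_const.max (continuous_const.min ((hcont _).sub (hcont f₀))))
  let u (n : ℕ) : Cp (Set.Iio κ) := (⟨(U n).piecewise (fun x => g (F n) n x) (c n),
    (hcont _).piecewise (by simp [(hU n).frontier_eq]) (hc n)⟩ : C(Set.Iio κ, ℝ))
  have hu (n : ℕ) (x : Set.Iio κ) : u n x = (U n).piecewise (fun x => g (F n) n x) (c n) x := rfl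
  refine ⟨u, fun n => hGW (F n) n _ fun x hx => ?_, ?_⟩
  · rw [hu]
    by_cases hxU : x ∈ U n
    · exact Set.piecewise_eq_of_mem _ _ _ hxU
    · rw [Set.piecewise_eq_of_notMem _ _ _ hxU]
      have hxF : x ∈ F n := by
        by_contra hxF
        refine hxU (mem_newGap_of_mem ?_ ?_)
        · exact Finset.mem_image_of_mem _ hx
        · simpa [E] using fun _ => hxF
      have := abs_lt.1 (hg (F n) n x hxF)
      simp only [c]
      rw [min_eq_right this.2.le, max_eq_right this.1.le]
      ring
  · refine isEmbedding_coe.tendsto_nhds_iff.2 (tendsto_pi_nhds.2 fun x => ?_)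
    have hlim := tendsto_one_div_add_atTop_nhds_zero_nat (𝕜 := ℝ)
    refine tendsto_iff_dist_tendsto_zero.2 (squeeze_zero' (.of_forall fun _ => dist_nonneg) ?_ hlim)
    filter_upwards [eventually_notMem_newGap hE (x : Ordinal)] with n hn
    have hxU : x ∉ U n := hn
    change dist (u n x) (f₀ x) ≤ _
    rw [hu, Set.piecewise_eq_of_notMem _ _ _ hxU, Real.dist_eq]
    simp only [c, add_sub_cancel_left]
    refine abs_le.2 ⟨le_max_left _ _, max_le ?_ (min_le_left _ _)⟩
    linarith [hδ n]

end Cp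

/-- For every ordinal `κ`, the space `C_p(κ)` is an Ascoli space. -/
theorem cp_ordinal_ascoli (κ : Ordinal) : AscoliSpace (Cp (Set.Iio κ)) := by
  refine IsEmbedding.of_comp
    (continuous_eval_of_exists_seq_of_isOpen Cp.exists_seq_of_mem_closure_isOpen)
    (g := fun Φ : C(C(Cp (Set.Iio κ), ℝ), ℝ) => fun x => Φ (Cp.evalAt x)) ?_ ?_
  · exact continuous_pi fun x => ContinuousEvalConst.continuous_eval_const _
  · exact Cp.isEmbedding_coe
end

section
/- For an ordinal κ, the space C_p(κ) is a k_ℝ-space if and only if the cofinality of κ is at most ω. -/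
open Topology

namespace Cp

open Filter

section General

variable {X : Type*} [TopologicalSpace X]

protected theorem continuous (f : Cp X) : Continuous (f : X → ℝ) :=
  ContinuousMap.continuous (show C(X, ℝ) from f)

theorem continuous_eval (x : X) : Continuous fun f : Cp X => f x :=
  (continuous_apply x).comp continuous_induced_dom

theorem tendsto_nhds_iff {ι : Type*} {l : Filter ι} {u : ι → Cp X} {f : Cp X} :
    Tendsto u l (𝓝 f) ↔ ∀ x, Tendsto (fun i => u i x) l (𝓝 (f x)) := by
  rw [nhds_induced, tendsto_comap_iff, tendsto_pi_nhds]
  rfl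

theorem eventually_forall_finset_abs_sub_lt (f : Cp X) (F : Finset X) {ε : ℝ} (hε : 0 < ε) :
    ∀ᶠ h in 𝓝 f, ∀ x ∈ F, |h x - f x| < ε := by
  rw [Filter.eventually_all_finset]
  intro x _
  have := (continuous_eval x).tendsto f
  exact (Metric.tendsto_nhds.1 this ε hε)

end General

/-- A countable set can be closed off under a countable-set-valued operation on finite sets. -/
theorem exists_countable_closed {X : Type*} (S : Finset X → Set X) (hS : ∀ F, (S F).Countable) :
    ∃ D : Set X, D.Countable ∧ ∀ F : Finset X, (F : Set X) ⊆ D → S F ⊆ D := by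
  let next : Set X → Set X := fun D => D ∪ ⋃ F ∈ {F : Finset X | (F : Set X) ⊆ D}, S F
  have hnext : ∀ D : Set X, D.Countable → (next D).Countable := fun D hD => by
    refine hD.union (Set.Countable.biUnion ?_ fun F _ => hS F)
    refine ((Set.countable_ofPred_finite_subset hD).preimage
      (f := fun F : Finset X => (F : Set X)) Finset.coe_injective).mono fun F hF => ?_
    exact ⟨F.finite_toSet, hF⟩
  let D : ℕ → Set X := fun n => next^[n] ∅
  have hsucc : ∀ n, D (n + 1) = next (D n) := fun n => Function.iterate_succ_apply' _ _ _
  have hmono : Monotone D := monotone_nat_of_le_succ fun n => by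
    rw [hsucc]
    exact Set.subset_union_left
  refine ⟨⋃ n, D n, Set.countable_iUnion fun n => ?_, fun F hF => ?_⟩
  · induction n with
    | zero => exact Set.countable_empty
    | succ n ih => rw [hsucc]; exact hnext _ ih
  · obtain ⟨n, hn⟩ := hmono.directed_le.exists_mem_subset_of_finset_subset_biUnion hF
    refine Set.Subset.trans ?_ (Set.subset_iUnion D (n + 1))
    rw [hsucc]
    exact Set.Subset.trans (Set.subset_biUnion_of_mem (u := S) hn) Set.subset_union_right

section Order

variable {X : Type*} [LinearOrder X] [TopologicalSpace X] [OrderTopology X]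

theorem exists_countable_forall_eq {φ : X → ℝ} (hφ : Continuous φ) (d : X) :
    ∃ C : Set X, C.Countable ∧ C ⊆ Set.Iio d ∧ ∀ x < d, (∀ c ∈ C, c < x) → φ x = φ d := by
  by_cases hd : ∃ y, y < d
  · have key : ∀ n : ℕ, ∃ b < d, Set.Ioc b d ⊆ {x | dist (φ x) (φ d) < 1 / ((n : ℝ) + 1)} :=
      fun n => exists_Ioc_subset_of_mem_nhds
        (Metric.tendsto_nhds.1 (hφ.tendsto d) _ Nat.one_div_pos_of_nat) hd
    choose b hbd hb using key
    refine ⟨Set.range b, Set.countable_range b, Set.range_subset_iff.2 hbd, fun x hx hC => ?_⟩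
    rw [← dist_le_zero]
    refine ge_of_tendsto' (tendsto_one_div_add_atTop_nhds_zero_nat (𝕜 := ℝ)) fun n => ?_
    exact (hb n ⟨hC _ ⟨n, rfl⟩, hx.le⟩).le
  · exact ⟨∅, Set.countable_empty, Set.empty_subset _, fun x hx => (hd ⟨x, hx⟩).elim⟩

variable [WellFoundedLT X]

/-- If `X` has a countable cofinal set, a point adherent to a subset of `Cp X` (described by a
predicate) is the limit of a sequence of elements of that subset. -/
theorem exists_seq_tendsto_of_frequently {C₀ : Set X} (hC₀ : C₀.Countable) (hcof : IsCofinal C₀)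
    {f : Cp X} {p : Cp X → Prop} (hp : ∃ᶠ h in 𝓝 f, p h) :
    ∃ u : ℕ → Cp X, Tendsto u atTop (𝓝 f) ∧ ∀ n, p (u n) := by
  classical
  rcases isEmpty_or_nonempty X with hX | ⟨⟨x₀⟩⟩
  · obtain ⟨h, hh⟩ := hp.exists
    exact ⟨fun _ => h, tendsto_nhds_iff.2 fun x => isEmptyElim x, fun _ => hh⟩
  have key : ∀ (F : Finset X) (n : ℕ),
      ∃ h : Cp X, p h ∧ ∀ x ∈ F, |h x - f x| < 1 / ((n : ℝ) + 1) := fun F n =>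
    (hp.and_eventually (eventually_forall_finset_abs_sub_lt f F Nat.one_div_pos_of_nat)).exists
  choose h hph hclose using key
  choose C hC hCd hCeq using fun F n =>
    exists_countable_forall_eq ((h F n).continuous.sub f.continuous)
  obtain ⟨D, hD, hDS⟩ := exists_countable_closed
    (fun G : Finset X => C₀ ∪ ⋃ F ∈ G.powerset, ⋃ n, ⋃ d ∈ G, C F n d) fun G =>
      hC₀.union (G.powerset.countable_toSet.biUnion fun F _ => Set.countable_iUnion fun n =>
        G.countable_toSet.biUnion fun d _ => hC F n d)
  have hC₀D : C₀ ⊆ D := Set.subset_union_left.trans (hDS ∅ (by simp))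
  have hCD : ∀ F : Finset X, (F : Set X) ⊆ D → ∀ n, ∀ d ∈ D, C F n d ⊆ D := by
    intro F hF n d hd y hy
    refine hDS (insert d F) (by simp [Set.insert_subset_iff, hd, hF]) (Or.inr ?_)
    simp only [Set.mem_iUnion]
    exact ⟨F, Finset.mem_powerset.2 (Finset.subset_insert d F), n, d,
      Finset.mem_insert_self d F, hy⟩
  have hrep : ∀ x, ∃ d ∈ D, ∀ F : Finset X, (F : Set X) ⊆ D → ∀ n,
      h F n x - f x = h F n d - f d := by
    intro x
    have hne : {c | c ∈ D ∧ x ≤ c}.Nonempty := by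
      obtain ⟨c, hc, hxc⟩ := hcof x
      exact ⟨c, hC₀D hc, hxc⟩
    obtain ⟨d, ⟨hdD, hxd⟩, hmin⟩ := WellFounded.has_min (wellFounded_lt (α := X)) _ hne
    refine ⟨d, hdD, fun F hF n => ?_⟩
    rcases hxd.eq_or_lt with rfl | hlt
    · rfl
    · refine hCeq F n d x hlt fun c hc => ?_
      by_contra hxc
      exact hmin c ⟨hCD F hF n d hdD hc, not_lt.1 hxc⟩ (hCd F n d hc)
  obtain ⟨c₀, hc₀, -⟩ := hcof x₀
  obtain ⟨e, rfl⟩ := hD.exists_eq_range ⟨c₀, hC₀D hc₀⟩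
  refine ⟨fun n => h ((Finset.range (n + 1)).image e) n, tendsto_nhds_iff.2 fun x => ?_,
    fun n => hph _ _⟩
  obtain ⟨_, ⟨k, rfl⟩, hk⟩ := hrep x
  rw [tendsto_iff_norm_sub_tendsto_zero]
  refine squeeze_zero' (Eventually.of_forall fun n => norm_nonneg _) ?_
    (tendsto_one_div_add_atTop_nhds_zero_nat (𝕜 := ℝ))
  filter_upwards [eventually_ge_atTop k] with n hn
  rw [hk _ (by simp) n]
  exact (hclose _ n _ (Finset.mem_image_of_mem e (Finset.mem_range.2 (by omega)))).le

theorem krSpace_of_countable_isCofinal {C₀ : Set X} (hC₀ : C₀.Countable) (hcof : IsCofinal C₀) :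
    KRSpace (Cp X) := by
  intro g hg
  rw [continuous_iff_continuousAt]
  intro f
  by_contra hf
  obtain ⟨ε, hε, hfreq⟩ : ∃ ε > 0, ∃ᶠ h in 𝓝 f, ¬ dist (g h) (g f) < ε := by
    rw [ContinuousAt, Metric.tendsto_nhds] at hf
    simpa only [not_forall, Filter.not_eventually, exists_prop] using hf
  obtain ⟨u, hu, hgu⟩ := exists_seq_tendsto_of_frequently hC₀ hcof hfreq
  have hcont := hg _ hu.isCompact_insert_range f (Set.mem_insert _ _)
  have hu' : Tendsto u atTop (𝓝[insert f (Set.range u)] f) :=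
    tendsto_nhdsWithin_iff.2 ⟨hu, Eventually.of_forall fun n => Or.inr ⟨n, rfl⟩⟩
  obtain ⟨n, hn⟩ := (Metric.tendsto_nhds.1 (hcont.tendsto.comp hu') ε hε).exists
  exact hgu n hn

theorem exists_tendsto_of_monotone (hX : ∀ C : Set X, C.Countable → ∃ x, ∀ c ∈ C, c < x)
    {a : ℕ → X} (ha : Monotone a) : ∃ x, Tendsto a atTop (𝓝 x) ∧ ∀ n, a n ≤ x := by
  have hne : (upperBounds (Set.range a)).Nonempty := by
    obtain ⟨x, hx⟩ := hX _ (Set.countable_range a)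
    exact ⟨x, fun c hc => (hx c hc).le⟩
  obtain ⟨x, hx, hmin⟩ := WellFounded.has_min (wellFounded_lt (α := X)) _ hne
  exact ⟨x, tendsto_atTop_isLUB ha ⟨hx, fun y hy => not_lt.1 (hmin y hy)⟩,
    fun n => hx ⟨n, rfl⟩⟩

theorem inter_nonempty_of_isClosed_of_unbounded
    (hX : ∀ C : Set X, C.Countable → ∃ x, ∀ c ∈ C, c < x) {A B : Set X}
    (hA : IsClosed A) (hB : IsClosed B) (hA' : ∀ x, ∃ a ∈ A, x < a) (hB' : ∀ x, ∃ b ∈ B, x < b) :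
    (A ∩ B).Nonempty := by
  choose p hpA hp using hA'
  choose q hqB hq using hB'
  obtain ⟨x₀, -⟩ := hX ∅ Set.countable_empty
  let a : ℕ → X := fun n => (fun x => q (p x))^[n] x₀
  have hsucc : ∀ n, a (n + 1) = q (p (a n)) := fun n => Function.iterate_succ_apply' _ _ _
  have hle : ∀ n, p (a n) ≤ a (n + 1) := fun n => by
    rw [hsucc]
    exact (hq _).le
  obtain ⟨x, hx, -⟩ := exists_tendsto_of_monotone hX (a := a)
    (monotone_nat_of_le_succ fun n => (hp (a n)).le.trans (hle n))
  have hx' := (tendsto_add_atTop_iff_nat 1).2 hx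
  refine ⟨x, hA.mem_of_tendsto
    (tendsto_of_tendsto_of_tendsto_of_le_of_le hx hx' (fun n => (hp (a n)).le) hle)
    (Eventually.of_forall fun n => hpA _), hB.mem_of_tendsto hx' (Eventually.of_forall fun n => ?_)⟩
  rw [hsucc]
  exact hqB _

theorem exists_forall_ge_eq (hX : ∀ C : Set X, C.Countable → ∃ x, ∀ c ∈ C, c < x)
    {φ : X → ℝ} (hφ : Continuous φ) : ∃ r : ℝ, ∃ b : X, ∀ x, b ≤ x → φ x = r := by
  obtain ⟨x₀, -⟩ := hX ∅ Set.countable_empty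
  have : Nonempty X := ⟨x₀⟩
  have hinter : CountableInterFilter (atTop : Filter X) := by
    refine ⟨fun S hS hmem => ?_⟩
    choose! b hb using fun s (hs : s ∈ S) => mem_atTop_sets.1 (hmem s hs)
    obtain ⟨x, hx⟩ := hX (b '' S) (hS.image b)
    refine mem_atTop_sets.2 ⟨x, fun y hy s hs => hb s hs y ?_⟩
    exact (hx _ ⟨s, hs, rfl⟩).le.trans hy
  obtain ⟨r, -, hr⟩ := (isLindelof_univ (X := ℝ)) (f := map φ atTop) (by simp)
  have hgt : ∀ x : X, ∃ y, x < y := fun x => by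
    obtain ⟨y, hy⟩ := hX {x} (Set.countable_singleton x)
    exact ⟨y, hy x rfl⟩
  have hfreq : ∀ {s : Set X}, (∃ᶠ x in atTop, x ∈ s) → ∀ x, ∃ y ∈ s, x < y := by
    intro s hs x
    obtain ⟨z, hz⟩ := hgt x
    obtain ⟨y, hy, hys⟩ := (frequently_atTop.1 hs) z
    exact ⟨y, hys, hz.trans_le hy⟩
  have hev : ∀ n : ℕ, ∀ᶠ x in atTop, dist (φ x) r < 1 / ((n : ℝ) + 1) := by
    intro n
    have hpos : (0 : ℝ) < 1 / ((n : ℝ) + 1) := Nat.one_div_pos_of_nat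
    by_contra hn
    have hA : ∃ᶠ x in atTop, x ∈ {x | 1 / ((n : ℝ) + 1) ≤ dist (φ x) r} := by
      simpa [Filter.Frequently] using hn
    have hB : ∃ᶠ x in atTop, x ∈ {x | dist (φ x) r ≤ 1 / ((n : ℝ) + 1) / 2} :=
      (MapClusterPt.frequently hr (Metric.closedBall_mem_nhds r (half_pos hpos)))
    obtain ⟨x, hxA, hxB⟩ := inter_nonempty_of_isClosed_of_unbounded hX
      (isClosed_le continuous_const (hφ.dist continuous_const))
      (isClosed_le (hφ.dist continuous_const) continuous_const) (hfreq hA) (hfreq hB)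
    simp only [Set.mem_ofPred_eq] at hxA hxB
    linarith
  obtain ⟨b, hb⟩ := mem_atTop_sets.1 (eventually_countable_forall.2 hev)
  refine ⟨r, b, fun x hx => ?_⟩
  rw [← dist_le_zero]
  exact ge_of_tendsto' (tendsto_one_div_add_atTop_nhds_zero_nat (𝕜 := ℝ)) fun n => (hb x hx n).le

/-- The limit at the end of `X` depends continuously on the function over compact sets. -/
theorem continuousOn_of_forall_ge_eq (hX : ∀ C : Set X, C.Countable → ∃ x, ∀ c ∈ C, c < x)
    {g : Cp X → ℝ} {b : Cp X → X} (hg : ∀ (f : Cp X) (x : X), b f ≤ x → f x = g f)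
    {K : Set (Cp X)} (hK : IsCompact K) : ContinuousOn g K := by
  classical
  intro f _
  by_contra hf
  obtain ⟨ε, hε, hfreq⟩ : ∃ ε > 0, ∃ᶠ h in 𝓝[K] f, ¬ dist (g h) (g f) < ε := by
    rw [ContinuousWithinAt, Metric.tendsto_nhds] at hf
    simpa only [not_forall, Filter.not_eventually, exists_prop] using hf
  have key : ∀ (F : Finset X) (n : ℕ), ∃ h : Cp X, h ∈ K ∧ ε ≤ dist (g h) (g f) ∧
      ∀ x ∈ F, |h x - f x| < 1 / ((n : ℝ) + 1) := fun F n => by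
    obtain ⟨h, ⟨h₁, h₂⟩, h₃⟩ := ((hfreq.and_eventually
      (eventually_nhdsWithin_of_eventually_nhds (eventually_forall_finset_abs_sub_lt f F
        Nat.one_div_pos_of_nat))).and_eventually self_mem_nhdsWithin).exists
    exact ⟨h, h₃, not_lt.1 h₁, h₂⟩
  choose h hhK hhε hclose using key
  have hbound : ∀ (F : Finset X) (n : ℕ), ∃ y, b f ≤ y ∧ b (h F n) ≤ y ∧ ∀ x ∈ F, x ≤ y := by
    intro F n
    obtain ⟨y, hy⟩ := hX _ (insert (b f) (insert (b (h F n)) F)).countable_toSet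
    exact ⟨y, (hy _ (by simp)).le, (hy _ (by simp)).le, fun x hx => (hy _ (by simp [hx])).le⟩
  choose y hyf hyh hyF using hbound
  let F : ℕ → Finset X := fun n => Nat.rec ∅ (fun n F => insert (y F n) F) n
  have hF : ∀ n, F (n + 1) = insert (y (F n) n) (F n) := fun n => rfl
  have hFmono : Monotone F := monotone_nat_of_le_succ fun n => by
    rw [hF]
    exact Finset.subset_insert _ _
  have hmem : ∀ {i n}, i < n → y (F i) i ∈ F n := fun {i n} hin =>
    hFmono (Nat.succ_le_of_lt hin) (by rw [hF]; exact Finset.mem_insert_self _ _)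
  obtain ⟨x, hx, hxle⟩ := exists_tendsto_of_monotone hX (a := fun n => y (F n) n)
    (monotone_nat_of_le_succ fun n => hyF _ _ _ (hmem n.lt_succ_self))
  obtain ⟨k, -, hk⟩ := hK.exists_mapClusterPt (f := atTop) (u := fun n => h (F n) n)
    (tendsto_principal.2 (Eventually.of_forall fun n => hhK _ _))
  have hk' : ∀ z, MapClusterPt (k z) atTop fun n => h (F n) n z := fun z =>
    hk.continuousAt_comp (continuous_eval z).continuousAt
  have heq : ∀ i, k (y (F i) i) = f (y (F i) i) := by
    intro i
    have hlim : Tendsto (fun n => h (F n) n (y (F i) i)) atTop (𝓝 (f (y (F i) i))) := by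
      rw [tendsto_iff_norm_sub_tendsto_zero]
      refine squeeze_zero' (Eventually.of_forall fun n => norm_nonneg _) ?_
        (tendsto_one_div_add_atTop_nhds_zero_nat (𝕜 := ℝ))
      filter_upwards [eventually_gt_atTop i] with n hn
      exact (hclose _ n _ (hmem hn)).le
    have := ClusterPt.mono (hk' (y (F i) i)) hlim
    exact eq_of_nhds_neBot this
  have hkx : k x = f x := tendsto_nhds_unique ((k.continuous.tendsto x).comp hx)
    (((f.continuous.tendsto x).comp hx).congr fun i => (heq i).symm)
  have hfar : ∀ n, ε ≤ dist (h (F n) n x) (f x) := fun n => by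
    rw [hg _ x ((hyh _ _).trans (hxle n)), hg f x ((hyf _ _).trans (hxle n))]
    exact hhε _ _
  obtain ⟨n, hn⟩ := ((hk' x).frequently (Metric.ball_mem_nhds _ hε)).exists
  rw [hkx] at hn
  exact (hfar n).not_gt hn

theorem exists_countable_isCofinal_of_krSpace (h : KRSpace (Cp X)) :
    ∃ C : Set X, C.Countable ∧ IsCofinal C := by
  classical
  by_contra! hcof
  have hX : ∀ C : Set X, C.Countable → ∃ x, ∀ c ∈ C, c < x := fun C hC => by
    simpa [IsCofinal] using hcof C hC
  obtain ⟨x₀, -⟩ := hX ∅ Set.countable_empty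
  have : Nonempty X := ⟨x₀⟩
  choose g b hg using fun f : Cp X => exists_forall_ge_eq hX f.continuous
  have hgcont : Continuous g := h g fun K hK => continuousOn_of_forall_ge_eq hX hg hK
  have hclopen : ∀ c : X, IsClopen (Set.Ioi c) := fun c => by
    refine ⟨?_, isOpen_Ioi⟩
    obtain ⟨y, hy⟩ := hX {c} (Set.countable_singleton c)
    obtain ⟨d, hd, hmin⟩ := WellFounded.has_min (wellFounded_lt (α := X)) (Set.Ioi c) ⟨y, hy c rfl⟩
    have : Set.Ioi c = Set.Ici d :=
      Set.ext fun z => ⟨fun hz => not_lt.1 (hmin z hz), fun hz => lt_of_lt_of_le hd hz⟩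
    rw [this]
    exact isClosed_Ici
  let χ : X → Cp X := fun c =>
    (⟨(Set.Ioi c).indicator fun _ => 1, (hclopen c).continuous_indicator continuous_const⟩ : C(X, ℝ))
  have hχ : ∀ c x, χ c x = (Set.Ioi c).indicator (fun _ => (1 : ℝ)) x := fun _ _ => rfl
  let z : Cp X := (0 : C(X, ℝ))
  have hz : ∀ x, z x = 0 := fun _ => rfl
  have hgz : g z = 0 := (hg z _ le_rfl).symm.trans (hz _)
  have hgχ : ∀ c, g (χ c) = 1 := fun c => by
    obtain ⟨y, hy⟩ := hX {c, b (χ c)} (Set.toFinite _).countable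
    rw [← hg (χ c) y (hy _ (by simp)).le, hχ, Set.indicator_of_mem (Set.mem_Ioi.2 (hy c (by simp)))]
  have hlim : Tendsto χ atTop (𝓝 z) := tendsto_nhds_iff.2 fun x => by
    refine tendsto_const_nhds.congr' ?_
    filter_upwards [eventually_ge_atTop x] with c hc
    rw [hz, hχ, Set.indicator_of_notMem (by simpa using hc)]
  have := (hgcont.tendsto z).comp hlim
  simp only [Function.comp_def, hgχ, hgz] at this
  exact one_ne_zero (tendsto_nhds_unique tendsto_const_nhds this)

theorem krSpace_iff_cof_le_aleph0 : KRSpace (Cp X) ↔ Order.cof X ≤ Cardinal.aleph0 := by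
  constructor
  · intro h
    obtain ⟨C, hC, hcof⟩ := exists_countable_isCofinal_of_krSpace h
    exact (Order.cof_le hcof).trans (Cardinal.le_aleph0_iff_set_countable.2 hC)
  · intro h
    obtain ⟨C, hcof, hC⟩ := Order.exists_cof_eq X
    exact krSpace_of_countable_isCofinal (Cardinal.le_aleph0_iff_set_countable.1 (hC ▸ h)) hcof

end Order

end Cp

/-- For an ordinal `κ`, the space `C_p(κ)` is a `k_ℝ`-space if and only if
the cofinality of `κ` is at most `ω`. -/
theorem cp_ordinal_kR_iff (κ : Ordinal) :
    KRSpace (Cp (Set.Iio κ)) ↔ κ.cof ≤ Cardinal.aleph0 := by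
  rw [Cp.krSpace_iff_cof_le_aleph0, Ordinal.cof_Iio, ← Ordinal.lift_cof, Cardinal.lift_le_aleph0]
end

section
/- For an ordinal κ, the space C_k(κ) of continuous real-valued functions on κ with the compact-open topology is an Ascoli space if and only if the cofinality of κ is at most ω. -/
open Topology

open Filter Set

/-- The evaluation map of a space into its second function space, precomposed with a continuous
map from a locally compact space, is continuous. -/
theorem continuous_evalMap_comp {S Y : Type*} [TopologicalSpace S] [LocallyCompactSpace S]
    [TopologicalSpace Y] {u : S → Y} (hu : Continuous u) :
    Continuous fun s : S =>
      (⟨fun f : C(Y, ℝ) => f (u s), ContinuousEvalConst.continuous_eval_const (u s)⟩ :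
        C(C(Y, ℝ), ℝ)) := by
  refine ContinuousMap.continuous_of_continuous_uncurry _ ?_
  have h : Continuous fun p : S × C(Y, ℝ) => (p.2.comp ⟨u, hu⟩) p.1 :=
    ((ContinuousMap.continuous_precomp ⟨u, hu⟩).comp continuous_snd).eval continuous_fst
  exact h

theorem CompletelyRegularSpace.ascoliSpace {Y : Type*} [TopologicalSpace Y] [T0Space Y]
    [CompletelyRegularSpace Y] [SequentialSpace Y] : AscoliSpace Y := by
  refine IsInducing.isEmbedding (isInducing_iff_nhds.2 fun y => le_antisymm ?_ ?_)
  · refine (Continuous.tendsto ?_ y).le_comap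
    exact continuous_from_compactlyGeneratedSpace _ fun K _ _ _ g hg =>
      continuous_evalMap_comp hg
  · intro U hU
    obtain ⟨V, hVU, hVo, hyV⟩ := mem_nhds_iff.1 hU
    obtain ⟨f, hf, hfy, hfV⟩ := completelyRegularSpace_iff_isOpen.1 inferInstance y V hVo hyV
    let F : C(Y, ℝ) := ⟨fun z => (f z : ℝ), by fun_prop⟩
    refine mem_comap.2 ⟨{φ | φ F < 1}, ?_, fun z hz => hVU ?_⟩
    · have hopen : IsOpen {φ : C(C(Y, ℝ), ℝ) | φ F < 1} :=
        isOpen_lt (ContinuousEvalConst.continuous_eval_const F) continuous_const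
      refine hopen.mem_nhds ?_
      simp [F, hfy]
    · by_contra hzV
      have : F z < 1 := hz
      simp [F, hfV hzV] at this

section WellOrder

variable {X : Type*} [TopologicalSpace X] [LinearOrder X] [OrderTopology X] [WellFoundedLT X]

/-- In a well-order in which countable sets are strictly bounded, a compact set of continuous
functions has only finitely many jumps of size at least `1 / 2` at successor points. -/
theorem IsCompact.finite_jumps [SuccOrder X] [LocallyCompactSpace X]
    (hX : ∀ S : Set X, S.Countable → ∃ b, ∀ a ∈ S, a < b) {C : Set C(X, ℝ)} (hC : IsCompact C) :
    {a : X | ∃ f ∈ C, 1 / 2 ≤ f (Order.succ a) - f a}.Finite := by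
  set A := {a : X | ∃ f ∈ C, 1 / 2 ≤ f (Order.succ a) - f a}
  by_contra hinf
  obtain ⟨S, hSA, hS, hSc⟩ : ∃ S ⊆ A, S.Infinite ∧ S.Countable := by
    have := (show A.Infinite from hinf).to_subtype
    refine ⟨range fun n => (Infinite.natEmbedding A n : X), ?_, ?_, countable_range _⟩
    · rintro _ ⟨n, rfl⟩
      exact Subtype.coe_prop _
    · exact infinite_range_of_injective
        (Subtype.val_injective.comp (Infinite.natEmbedding A).injective)
  obtain ⟨b, hb⟩ := hX S hSc
  obtain ⟨c, hc, hmin⟩ := WellFounded.has_min (wellFounded_lt (α := X))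
    {c | (A ∩ Iio c).Infinite} ⟨b, hS.mono fun a ha => ⟨hSA ha, hb a ha⟩⟩
  obtain ⟨a₀, -, ha₀⟩ := Set.Infinite.nonempty hc
  have hev : ∀ᶠ x in 𝓝 c, ∀ f ∈ C, dist (f c) (f x) < 1 / 4 :=
    Metric.tendstoUniformlyOn_iff.1
      (ContinuousMap.tendsto_iff_forall_isCompact_tendstoUniformlyOn.1
        ((continuous_evalMap_comp (continuous_id (X := X))).tendsto c) C hC) _ (by norm_num)
  obtain ⟨d, hdc, hd⟩ := exists_Ioc_subset_of_mem_nhds hev ⟨a₀, ha₀⟩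
  have hfin : (A ∩ Iic d).Finite := by
    have h : (A ∩ Iio d).Finite := by
      by_contra h
      exact hmin d h hdc
    refine (h.insert d).subset fun a ha => ?_
    rcases (show a ≤ d from ha.2).eq_or_lt with h | h
    · exact Or.inl h
    · exact Or.inr ⟨ha.1, h⟩
  obtain ⟨a, ⟨haA, hac⟩, had⟩ := (Set.Infinite.sdiff hc hfin).nonempty
  have hda : d < a := not_le.1 fun h => had ⟨haA, h⟩
  obtain ⟨f, hf, hjump⟩ := haA
  have h₁ := hd ⟨hda, le_of_lt hac⟩ f hf
  have h₂ := hd ⟨hda.trans_le (Order.le_succ a), Order.succ_le_of_lt hac⟩ f hf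
  rw [Real.dist_eq, abs_lt] at h₁ h₂
  linarith [h₁.1, h₁.2, h₂.1, h₂.2]

theorem not_ascoliSpace_of_countable_bounded [SuccOrder X] [LocallyCompactSpace X]
    (hX : ∀ S : Set X, S.Countable → ∃ b, ∀ a ∈ S, a < b) : ¬ AscoliSpace C(X, ℝ) := by
  intro hAsc
  obtain ⟨x₀, -⟩ := hX ∅ countable_empty
  have : Nonempty X := ⟨x₀⟩
  have : NoMaxOrder X := ⟨fun a => by simpa using hX {a} (countable_singleton a)⟩
  -- The functionals detecting jumps tend to zero.
  let φ : X → C(C(X, ℝ), ℝ) := fun a =>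
    ⟨fun g => max 0 (g (Order.succ a) - g a - 1 / 2), by fun_prop⟩
  have hφ : Tendsto φ cofinite (𝓝 0) := by
    refine ContinuousMap.tendsto_iff_forall_isCompact_tendstoUniformlyOn.2 fun C hC => ?_
    refine Metric.tendstoUniformlyOn_iff.2 fun ε hε => ?_
    filter_upwards [(hC.finite_jumps hX).compl_mem_cofinite] with a ha f hf
    have : f (Order.succ a) - f a < 1 / 2 := not_le.1 fun h => ha ⟨f, hf, h⟩
    have h0 : φ a f = 0 := max_eq_left (by linarith)
    simpa [h0] using hε
  -- The indicators of final segments tend to zero.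
  have hclopen (a : X) : IsClopen (Ioi a) := by
    refine ⟨?_, isOpen_Ioi⟩
    rw [← Order.Ici_succ]
    exact isClosed_Ici
  let e : X → C(X, ℝ) := fun a =>
    ⟨(Ioi a).indicator fun _ => 1, (hclopen a).continuous_indicator continuous_const⟩
  have e_apply (a x : X) : e a x = if a < x then 1 else 0 := by
    simp [e, indicator_apply]
  have he : Tendsto e atTop (𝓝 0) := by
    refine ContinuousMap.tendsto_iff_forall_isCompact_tendstoUniformlyOn.2 fun Q hQ => ?_
    refine Metric.tendstoUniformlyOn_iff.2 fun ε hε => ?_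
    obtain ⟨b, hb⟩ := hQ.bddAbove
    filter_upwards [eventually_ge_atTop b] with a ha x hx
    have h0 : e a x = 0 := (e_apply _ _).trans <| if_neg (not_lt.2 ((hb hx).trans ha))
    simpa [h0] using hε
  have hlim := Metric.tendstoUniformlyOn_iff.1
    (ContinuousMap.tendsto_iff_forall_isCompact_tendstoUniformlyOn.1
      ((hAsc.continuous.tendsto 0).comp he) _ hφ.isCompact_insert_range_of_cofinite)
    (1 / 2) (by norm_num)
  obtain ⟨a, ha⟩ := hlim.exists
  have h := ha (φ a) (Or.inr ⟨a, rfl⟩)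
  have h₁ : e a (Order.succ a) = 1 := (e_apply _ _).trans <| if_pos (Order.lt_succ a)
  have h₀ : e a a = 0 := (e_apply _ _).trans <| if_neg (lt_irrefl a)
  have hz : φ a 0 = 0 := by simp [φ]
  have hv : φ a (e a) = 1 / 2 := by
    change max 0 (e a (Order.succ a) - e a a - 1 / 2) = 1 / 2
    rw [h₁, h₀]
    norm_num
  change dist (φ a 0) (φ a (e a)) < 1 / 2 at h
  rw [hz, hv] at h
  norm_num at h

end WellOrder

theorem Ordinal.isCompact_Iic_Iio {κ : Ordinal} (a : Iio κ) : IsCompact (Iic a) := by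
  rw [Subtype.isCompact_iff]
  convert isCompact_Icc (a := (0 : Ordinal)) (b := a) using 1
  ext x
  constructor
  · rintro ⟨y, hy, rfl⟩
    exact ⟨bot_le, hy⟩
  · rintro ⟨-, hx⟩
    exact ⟨⟨x, hx.trans_lt a.2⟩, hx, rfl⟩

theorem Ordinal.locallyCompactSpace_Iio (κ : Ordinal) : LocallyCompactSpace (Iio κ) := by
  have : WeaklyLocallyCompactSpace (Iio κ) := by
    refine ⟨fun a => ⟨Iic a, isCompact_Iic_Iio a, ?_⟩⟩
    have h : Iic a = Subtype.val ⁻¹' Iio (Order.succ (a : Ordinal)) := by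
      ext x
      exact (Order.lt_succ_iff (b := (a : Ordinal))).symm
    rw [h]
    exact (isOpen_Iio.preimage continuous_subtype_val).mem_nhds (Order.lt_succ (a : Ordinal))
  infer_instance

theorem Ordinal.sigmaCompactSpace_Iio {κ : Ordinal} {S : Set (Iio κ)} (hS : IsCofinal S)
    (hc : S.Countable) : SigmaCompactSpace (Iio κ) := by
  refine SigmaCompactSpace.of_countable (Iic '' S) (hc.image _)
    (forall_mem_image.2 fun a _ => isCompact_Iic_Iio a) (eq_univ_of_forall fun x => ?_)
  obtain ⟨a, ha, hxa⟩ := hS x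
  exact ⟨Iic a, mem_image_of_mem _ ha, hxa⟩

/-- For an ordinal `κ`, the space `C_k(κ)` (with the compact-open topology) is an
Ascoli space if and only if the cofinality of `κ` is at most `ω`. -/
theorem ck_ordinal_ascoli_iff (κ : Ordinal) :
    AscoliSpace C(Set.Iio κ, ℝ) ↔ κ.cof ≤ Cardinal.aleph0 := by
  have hcof : κ.cof ≤ Cardinal.aleph0 ↔ Order.cof (Iio κ) ≤ Cardinal.aleph0 := by
    rw [Ordinal.cof_Iio, ← Ordinal.lift_cof, Cardinal.lift_le_aleph0]
  have : LocallyCompactSpace (Iio κ) := Ordinal.locallyCompactSpace_Iio κ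
  rw [hcof]
  constructor
  · contrapose!
    intro h
    refine not_ascoliSpace_of_countable_bounded fun S hS => ?_
    have hS' : ¬ IsCofinal S := fun hcf =>
      ((Order.cof_le hcf).trans (Cardinal.le_aleph0_iff_set_countable.2 hS)).not_gt h
    simpa [IsCofinal] using hS'
  · intro h
    obtain ⟨S, hS, hSc⟩ := Order.exists_cof_eq (Iio κ)
    have := Ordinal.sigmaCompactSpace_Iio hS
      (Cardinal.le_aleph0_iff_set_countable.1 (hSc.trans_le h))
    exact CompletelyRegularSpace.ascoliSpace
end

section
/- Let κ be an ordinal whose cofinality is strictly greater than ω. Then for every compact subset C of C_k(κ), the set of ordinals α < κ for which there exists f ∈ C with f(α) < 1/4 and f(α+1) > 3/4 is finite. -/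
open Topology

/-- The ordinals with the order topology are locally compact: `[0, a] = [0, a + 1)` is a compact
neighbourhood of `a`. -/
theorem Ordinal.locallyCompactSpace : LocallyCompactSpace Ordinal := by
  have : WeaklyLocallyCompactSpace Ordinal :=
    ⟨fun a => ⟨Set.Icc 0 a, isCompact_Icc, by
      filter_upwards [Iio_mem_nhds (Order.lt_add_one_iff.2 le_rfl : a < a + 1)] with b hb
      exact ⟨zero_le, Order.lt_add_one_iff.1 hb⟩⟩⟩
  infer_instance

/-- An infinite set of ordinals contains a strictly increasing sequence. -/
theorem Ordinal.exists_strictMono_of_infinite {s : Set Ordinal} (hs : s.Infinite) :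
    ∃ a : ℕ → Ordinal, StrictMono a ∧ ∀ n, a n ∈ s := by
  let e := hs.natEmbedding
  obtain ⟨g, hg⟩ := (Set.IsPWO.of_linearOrder s).exists_monotone_subseq fun n => (e n).2
  refine ⟨fun n => e (g n), hg.strictMono_of_injective ?_, fun n => (e (g n)).2⟩
  exact Subtype.val_injective.comp (e.injective.comp g.injective)

/-- In a locally compact space, members of a compact set of real-valued continuous functions
cannot be uniformly separated along two sequences with the same limit. -/
theorem IsCompact.exists_eval_lt_of_tendsto {X : Type*} [TopologicalSpace X]
    [LocallyCompactSpace X] {C : Set C(X, ℝ)} (hC : IsCompact C) {f : ℕ → C(X, ℝ)}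
    (hf : ∀ n, f n ∈ C) {x y : ℕ → X} {b : X} (hx : Filter.Tendsto x Filter.atTop (𝓝 b))
    (hy : Filter.Tendsto y Filter.atTop (𝓝 b)) {ε : ℝ} (hε : 0 < ε) :
    ∃ n, f n (y n) < f n (x n) + ε := by
  obtain ⟨g, -, hg⟩ := hC.exists_mapClusterPt_of_frequently
    (Filter.Eventually.of_forall hf).frequently (l := Filter.atTop)
  have hev : Filter.Tendsto (fun p : C(X, ℝ) × X => p.1 p.2) (𝓝 g ×ˢ 𝓝 b) (𝓝 (g b)) := by
    rw [← nhds_prod_eq]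
    exact (ContinuousEval.continuous_eval (F := C(X, ℝ))).tendsto (g, b)
  obtain ⟨p, hp, q, hq, hpq⟩ := Filter.eventually_prod_iff.1
    (hev.eventually (Metric.ball_mem_nhds (g b) (half_pos hε)))
  obtain ⟨n, hn, hxn, hyn⟩ :=
    ((hg.frequently hp).and_eventually ((hx.eventually hq).and (hy.eventually hq))).exists
  have hxd := abs_lt.1 (hpq hn hxn)
  have hyd := abs_lt.1 (hpq hn hyn)
  exact ⟨n, by linarith [hxd.1, hyd.2]⟩

/-- If `cf(κ) > ω`, then for every compact subset `C` of `C_k(κ)`, the set of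
ordinals `α < κ` for which some `f ∈ C` satisfies `f(α) < 1/4` and `f(α+1) > 3/4`
is finite. -/
theorem ck_ordinal_compact_finite (κ : Ordinal) (hκ : Cardinal.aleph0 < κ.cof)
    (C : Set C(Set.Iio κ, ℝ)) (hC : IsCompact C) :
    {α : Ordinal | ∃ (hα : α + 1 < κ), ∃ f ∈ C,
      f ⟨α, lt_of_le_of_lt (le_self_add : α ≤ α + 1) hα⟩ < 1 / 4 ∧
      3 / 4 < f ⟨α + 1, hα⟩}.Finite := by
  have := Ordinal.locallyCompactSpace
  have : LocallyCompactSpace (Set.Iio κ) := isOpen_Iio.locallyCompactSpace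
  by_contra hs
  obtain ⟨a, ha, has⟩ := Ordinal.exists_strictMono_of_infinite hs
  choose haκ f hfC hf using has
  have hbdd : BddAbove (Set.range a) := Ordinal.bddAbove_of_small
  have hb : ⨆ n, a n < κ := Ordinal.lift_iSup_lt_of_lt_cof (by simpa using hκ)
    fun n => lt_of_le_of_lt le_self_add (haκ n)
  have hlim := tendsto_atTop_ciSup ha.monotone hbdd
  have hlim' : Filter.Tendsto (fun n => a n + 1) Filter.atTop (𝓝 (⨆ n, a n)) :=
    tendsto_of_tendsto_of_tendsto_of_le_of_le hlim tendsto_const_nhds (fun n => le_self_add)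
      fun n => (Order.add_one_le_of_lt (ha n.lt_succ_self)).trans (le_ciSup hbdd _)
  obtain ⟨n, hn⟩ := hC.exists_eval_lt_of_tendsto hfC
    (x := fun n => ⟨a n, lt_of_le_of_lt le_self_add (haκ n)⟩) (y := fun n => ⟨a n + 1, haκ n⟩)
    (b := ⟨⨆ n, a n, hb⟩) (tendsto_subtype_rng.2 hlim) (tendsto_subtype_rng.2 hlim')
    (ε := 1 / 2) (by norm_num)
  linarith [(hf n).1, (hf n).2]
end

section
/- Let X be a locally compact Hausdorff scattered topological space. Then C_p(X) contains a dense subspace which is Fréchet–Urysohn in its subspace topology; namely, the set of all continuous real-valued functions on X that extend continuously to the one-point compactification of X with value 0 at the point at infinity is dense in C_p(X) and is Fréchet–Urysohn. -/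
open Topology

open Set Filter

/-- A continuous image of a compact scattered space in a second countable Hausdorff space is
countable: a minimal closed set mapping onto a perfect subset of the image would have no
isolated points. -/
theorem Scattered.countable_range.{u} {K Y : Type u} [TopologicalSpace K] [CompactSpace K]
    [TopologicalSpace Y] [T2Space Y] [SecondCountableTopology Y] (hK : Scattered K)
    {φ : K → Y} (hφ : Continuous φ) : (range φ).Countable := by
  by_contra hunc
  obtain ⟨P, hP, ⟨p₀, hp₀⟩, hPsub⟩ :=
    exists_perfect_nonempty_of_isClosed_of_not_countable (isCompact_range hφ).isClosed hunc
  have : CompactSpace (φ ⁻¹' P) :=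
    isCompact_iff_compactSpace.mp (hP.closed.preimage hφ).isCompact
  have hsurj : Function.Surjective (P.restrictPreimage φ) := by
    rintro ⟨p, hp⟩
    obtain ⟨k, rfl⟩ := hPsub hp
    exact ⟨⟨k, hp⟩, rfl⟩
  obtain ⟨E, hEc, hE, hmin⟩ :=
    exists_compact_surjective_zorn_subset hφ.restrictPreimage hsurj
  have hlift : ∀ p ∈ P, ∃ e : E, φ e = p := by
    intro p hp
    obtain ⟨e, he, hep⟩ : (⟨p, hp⟩ : P) ∈ P.restrictPreimage φ '' E := hE ▸ mem_univ _
    exact ⟨⟨e, he⟩, congrArg Subtype.val hep⟩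
  let ι : E → K := fun e => e
  have hι : Continuous ι := continuous_subtype_val.comp continuous_subtype_val
  obtain ⟨e₀, -⟩ := hlift p₀ hp₀
  obtain ⟨-, ⟨a, rfl⟩, U, hU, hUa⟩ := hK (range ι) ⟨ι e₀, e₀, rfl⟩
  have haU : ι a ∈ U := (hUa ▸ mem_singleton (ι a) : ι a ∈ U ∩ range ι).1
  have huniq : ∀ e : E, ι e ∈ U → ι e = ι a := fun e he =>
    (hUa ▸ ⟨he, e, rfl⟩ : ι e ∈ ({ι a} : Set K))
  have hclosed : IsClosed (ι ⁻¹' U)ᶜ := (hU.preimage hι).isClosed_compl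
  have hproper : (ι ⁻¹' U)ᶜ ≠ univ := fun h => (h ▸ mem_univ a : a ∈ (ι ⁻¹' U)ᶜ) haU
  have himage : IsClosed ((φ ∘ ι) '' (ι ⁻¹' U)ᶜ) :=
    (hclosed.isCompact.image (hφ.comp hι)).isClosed
  obtain ⟨⟨p, hp⟩, hpn⟩ := (ne_univ_iff_exists_notMem _).mp (hmin _ hproper hclosed)
  have hmiss : φ (ι a) ∉ (φ ∘ ι) '' (ι ⁻¹' U)ᶜ := by
    obtain ⟨e, rfl⟩ := hlift p hp
    by_cases he : ι e ∈ U
    · rw [← huniq e he]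
      rintro ⟨e', he', h⟩
      exact hpn ⟨e', he', Subtype.ext h⟩
    · exact absurd ⟨e, he, rfl⟩ hpn
  obtain ⟨y, ⟨hy, hyP⟩, hne⟩ :=
    preperfect_iff_nhds.mp hP.acc (φ (ι a)) a.1.2 _ (himage.isOpen_compl.mem_nhds hmiss)
  obtain ⟨e, rfl⟩ := hlift y hyP
  by_cases he : ι e ∈ U
  · exact hne (congrArg φ (huniq e he))
  · exact hy ⟨e, he, rfl⟩

/-- The closure in the topology of pointwise convergence, in terms of finite sets and `ε`. -/
theorem mem_closure_pi_real_iff {K : Type*} {A : Set (K → ℝ)} {g : K → ℝ} :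
    g ∈ closure A ↔
      ∀ (F : Finset K) (ε : ℝ), 0 < ε → ∃ f ∈ A, ∀ x ∈ F, dist (f x) (g x) < ε := by
  constructor
  · intro hg F ε hε
    have hopen : IsOpen ((F : Set K).pi fun x => Metric.ball (g x) ε) :=
      isOpen_set_pi F.finite_toSet fun _ _ => Metric.isOpen_ball
    obtain ⟨f, hf, hfA⟩ :=
      mem_closure_iff.mp hg _ hopen fun x _ => Metric.mem_ball_self hε
    exact ⟨f, hfA, fun x hx => hf x hx⟩
  · intro h
    refine mem_closure_iff.mpr fun O hO hgO => ?_
    obtain ⟨F, u, hu, hFO⟩ := isOpen_pi_iff.mp hO g hgO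
    have hball : ∀ᶠ ε in 𝓝[>] (0 : ℝ), ∀ x ∈ F, Metric.ball (g x) ε ⊆ u x := by
      refine (eventually_all_finset F).mpr fun x hx => ?_
      obtain ⟨δ, hδ, hsub⟩ := Metric.isOpen_iff.mp (hu x hx).1 _ (hu x hx).2
      filter_upwards [Ioc_mem_nhdsGT hδ] with ε hε
      exact (Metric.ball_subset_ball hε.2).trans hsub
    obtain ⟨ε, hε, hpos⟩ := (hball.and self_mem_nhdsWithin).exists
    obtain ⟨f, hfA, hf⟩ := h F ε hpos
    exact ⟨f, hFO fun x hx => hε x hx (hf x hx), hfA⟩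

/-- The space of continuous functions on a compact space has countable tightness in the topology
of pointwise convergence. -/
theorem exists_countable_subset_mem_closure_pi {K : Type*} [TopologicalSpace K] [CompactSpace K]
    {A : Set (K → ℝ)} (hA : ∀ f ∈ A, Continuous f) {g : K → ℝ} (hg : Continuous g)
    (hgA : g ∈ closure A) : ∃ B ⊆ A, B.Countable ∧ g ∈ closure B := by
  have hcover : ∀ n m : ℕ, ∃ T ⊆ A, T.Finite ∧
      ∀ x : Fin n → K, ∃ f ∈ T, ∀ i, dist (f (x i)) (g (x i)) < 1 / ((m : ℝ) + 1) := by
    intro n m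
    obtain ⟨T, hTA, hT, hcov⟩ := (isCompact_univ (X := Fin n → K)).elim_finite_subcover_image
      (b := A) (c := fun f => {x | ∀ i, dist (f (x i)) (g (x i)) < 1 / ((m : ℝ) + 1)})
      (fun f hf => by
        have := hA f hf
        simp only [ofPred_forall]
        exact isOpen_iInter_of_finite fun i => isOpen_lt (by fun_prop) continuous_const)
      (fun x _ => by
        classical
        obtain ⟨f, hf, hfx⟩ := mem_closure_pi_real_iff.mp hgA (Finset.univ.image x) _
          (Nat.one_div_pos_of_nat (n := m))
        exact mem_biUnion hf fun i => hfx _ (Finset.mem_image_of_mem x (Finset.mem_univ i)))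
    refine ⟨T, hTA, hT, fun x => ?_⟩
    simpa using hcov (mem_univ x)
  choose T hTA hT hcov using hcover
  refine ⟨⋃ n, ⋃ m, T n m, iUnion_subset fun n => iUnion_subset fun m => hTA n m,
    countable_iUnion fun n => countable_iUnion fun m => (hT n m).countable, ?_⟩
  refine mem_closure_pi_real_iff.mpr fun F ε hε => ?_
  obtain ⟨m, hm⟩ := exists_nat_one_div_lt hε
  obtain ⟨f, hf, hfx⟩ := hcov F.card m fun i => F.equivFin.symm i
  refine ⟨f, mem_iUnion₂.mpr ⟨_, m, hf⟩, fun x hx => ?_⟩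
  simpa using (hfx (F.equivFin ⟨x, hx⟩)).trans hm

/-- The space of continuous functions on a compact scattered space is Fréchet–Urysohn in the
topology of pointwise convergence. -/
theorem Scattered.exists_seq_tendsto_pi {K : Type*} [TopologicalSpace K] [CompactSpace K]
    (hK : Scattered K) {A : Set (K → ℝ)} (hA : ∀ f ∈ A, Continuous f) {g : K → ℝ}
    (hg : Continuous g) (hgA : g ∈ closure A) :
    ∃ u : ℕ → K → ℝ, (∀ n, u n ∈ A) ∧ Tendsto u atTop (𝓝 g) := by
  obtain ⟨B, hBA, hB, hgB⟩ := exists_countable_subset_mem_closure_pi hA hg hgA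
  have : Countable B := hB
  let φ : K → ℝ × (B → ℝ) := fun x => (g x, fun f => f.1 x)
  have hφ : Continuous φ :=
    hg.prodMk (continuous_pi fun f => hA f (hBA f.2))
  have : Countable (range φ) := hK.countable_range hφ
  let s : range φ → K := rangeSplitting φ
  have hs : ∀ x, φ (s ⟨φ x, x, rfl⟩) = φ x := fun x => apply_rangeSplitting φ _
  let r : (K → ℝ) → range φ → ℝ := fun f y => f (s y)
  have hr : Continuous r := by fun_prop
  obtain ⟨v, hv, hlim⟩ := mem_closure_iff_seq_limit.mp
    (image_closure_subset_closure_image hr (mem_image_of_mem r hgB))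
  choose u huB hu using hv
  refine ⟨u, fun n => hBA (huB n), tendsto_pi_nhds.mpr fun x => ?_⟩
  have hgx : g (s ⟨φ x, x, rfl⟩) = g x := congrArg Prod.fst (hs x)
  have hux : ∀ n, v n ⟨φ x, x, rfl⟩ = u n x := fun n => by
    rw [← hu n]
    exact congrFun (congrArg Prod.snd (hs x)) ⟨u n, huB n⟩
  simpa only [hux, r, hgx] using tendsto_pi_nhds.mp hlim ⟨φ x, x, rfl⟩

/-- The one-point compactification of a scattered space is scattered. -/
theorem Scattered.onePoint {X : Type*} [TopologicalSpace X] (hX : Scattered X) :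
    Scattered (OnePoint X) := by
  intro A hA
  by_cases h : ((↑) ⁻¹' A : Set X).Nonempty
  · obtain ⟨a, ha, U, hU, hUa⟩ := hX _ h
    refine ⟨a, ha, (↑) '' U, OnePoint.isOpenEmbedding_coe.isOpenMap U hU, ?_⟩
    rw [← image_inter_preimage, hUa, image_singleton]
  · have hinfty : A = {OnePoint.infty} := by
      refine hA.subset_singleton_iff.mp fun p hp => ?_
      induction p with
      | infty => rfl
      | coe x => exact absurd ⟨x, hp⟩ h
    exact ⟨OnePoint.infty, by simp [hinfty], univ, isOpen_univ, by simp [hinfty]⟩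

/-- For a locally compact Hausdorff scattered space `X`, the set of continuous
real-valued functions on `X` extending continuously to the one-point compactification
with value `0` at `∞` is dense in `C_p(X)` and is Fréchet–Urysohn in its subspace
topology. -/
theorem cp_dense_frechetUrysohn_subspace (X : Type*) [TopologicalSpace X]
    [LocallyCompactSpace X] [T2Space X] (hX : Scattered X) :
    let Z : Set (Cp X) := {g | ∃ f : C(OnePoint X, ℝ),
      f OnePoint.infty = 0 ∧ ∀ x : X, f x = g x}
    Dense Z ∧ FrechetUrysohnSpace Z := by
  intro Z
  have hcoe : IsInducing fun f : Cp X => (f : X → ℝ) := ⟨rfl⟩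
  constructor
  · intro g
    rw [hcoe.closure_eq_preimage_closure_image, mem_preimage, mem_closure_pi_real_iff]
    intro F ε hε
    obtain ⟨k, hk, -, hsupp, -⟩ := exists_continuous_one_zero_of_isCompact
      F.finite_toSet.isCompact isClosed_empty (disjoint_empty _)
    let f : C(X, ℝ) := k * (show C(X, ℝ) from g)
    have hf : HasCompactSupport f := hsupp.mul_right
    have hlim : Tendsto f (coclosedCompact X) (𝓝 0) := by
      rw [coclosedCompact_eq_cocompact]
      exact hf.is_zero_at_infty
    refine ⟨f, ⟨f, ⟨OnePoint.continuousMapMk f 0 hlim, rfl, fun x => rfl⟩, rfl⟩, fun x hx => ?_⟩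
    have hfx : f x = g x := by
      change k x * g x = g x
      rw [hk hx, Pi.one_apply, one_mul]
    rwa [hfx, dist_self]
  · refine ⟨fun s z hz => ?_⟩
    let e : Z → OnePoint X → ℝ := fun z p => p.elim 0 z.1
    have hval : IsInducing fun z : Z => (z.1 : X → ℝ) := hcoe.comp .subtypeVal
    have he : Continuous e := continuous_pi fun p => by
      induction p with
      | infty => exact continuous_const
      | coe x => exact (continuous_apply x).comp hval.continuous
    have hext : ∀ z, Continuous (e z) := by
      rintro ⟨g, f, hf, hfg⟩
      convert f.continuous using 1
      funext p
      induction p with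
      | infty => exact hf.symm
      | coe x => exact (hfg x).symm
    obtain ⟨u, hu, hlim⟩ := hX.onePoint.exists_seq_tendsto_pi (A := e '' s)
      (forall_mem_image.mpr fun z _ => hext z) (hext z)
      (image_closure_subset_closure_image he (mem_image_of_mem e hz))
    choose w hws hwu using hu
    refine ⟨w, hws, hval.tendsto_nhds_iff.mpr (tendsto_pi_nhds.mpr fun x => ?_)⟩
    have hx := tendsto_pi_nhds.mp hlim (x : OnePoint X)
    simp only [← hwu] at hx
    exact hx
end
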